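/- For all integers k and x with k ≥ 3 and 2 ≤ x ≤ k−1, there exists a (k, x)-transmitter; that is, a (P_k, P_k)-good graph G with a vertex v such that in every (P_k, P_k)-good coloring of G, either v is a strict endpoint of a red P_x and is incident to no blue edge, or v is a strict endpoint of a blue P_x and is incident to no red edge. -/

import Mathlib

/-- `G` contains a path on `n` vertices (as a subgraph). -/
def HasNPath {V : Type*} (G : SimpleGraph V) (n : ℕ) : Prop :=
  ∃ (u w : V) (p : G.Walk u w), p.IsPath ∧ p.length + 1 = n

/-- `v` is an endpoint of a path on `n` vertices in `G`. -/
def IsPathEndpoint {V : Type*} (G : SimpleGraph V) (v : V) (n : ℕ) : Prop :=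
  ∃ (w : V) (p : G.Walk v w), p.IsPath ∧ p.length + 1 = n

/-- `x` is the maximum number of vertices of a path in `G` having `v` as an endpoint;
we then say `v` is a strict endpoint of a `P_x` in `G`. -/
def StrictEndpoint {V : Type*} (G : SimpleGraph V) (v : V) (x : ℕ) : Prop :=
  IsPathEndpoint G v x ∧ ∀ y, IsPathEndpoint G v y → y ≤ x

/-- A red/blue coloring of the edges of `G` is given by its red subgraph `R ≤ G`;
the blue subgraph is `G \ R`.  The coloring is `(P_k, P_ℓ)`-good if the red subgraph
has no path on `k` vertices and the blue subgraph has no path on `ℓ` vertices. -/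
def GoodColoring {V : Type*} (G R : SimpleGraph V) (k ℓ : ℕ) : Prop :=
  R ≤ G ∧ ¬ HasNPath R k ∧ ¬ HasNPath (G \ R) ℓ

/-- `G` is `(P_k, P_ℓ)`-good if it admits at least one `(P_k, P_ℓ)`-good coloring. -/
def IsGood {V : Type*} (G : SimpleGraph V) (k ℓ : ℕ) : Prop :=
  ∃ R : SimpleGraph V, GoodColoring G R k ℓ

open SimpleGraph

variable {V W : Type*} {G H R : SimpleGraph V} {u v : V} {k d n : ℕ}

/-! ### Paths as lists of vertices -/

/-- The list `l` enumerates the vertices of a path of `G`. -/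
def IsPathList (G : SimpleGraph V) (l : List V) : Prop :=
  l.IsChain G.Adj ∧ l.Nodup

theorem isPathEndpoint_iff_list :
    IsPathEndpoint G v n ↔ ∃ l, IsPathList G (v :: l) ∧ l.length + 1 = n := by
  constructor
  · rintro ⟨w, p, hp, rfl⟩
    refine ⟨p.support.tail, ⟨?_, ?_⟩, ?_⟩
    · rw [Walk.cons_tail_support]; exact p.isChain_adj_support
    · rw [Walk.cons_tail_support]; exact hp.support_nodup
    · simp
  · rintro ⟨l, ⟨hc, hn⟩, rfl⟩
    have hne : v :: l ≠ [] := List.cons_ne_nil v l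
    refine ⟨_, Walk.ofSupport (v :: l) hne hc, ?_, ?_⟩
    · apply Walk.IsPath.mk'
      exact (Walk.support_ofSupport hne hc).symm ▸ hn
    · exact congrArg (· + 1) (Walk.length_ofSupport hne hc)

theorem IsPathList.hasNPath {l : List V} (h : IsPathList G l) (hl : l ≠ []) :
    HasNPath G l.length := by
  cases l with
  | nil => exact absurd rfl hl
  | cons v l => exact ⟨v, isPathEndpoint_iff_list.2 ⟨l, h, by simp⟩⟩

theorem HasNPath.exists_list (h : HasNPath G n) : ∃ l, IsPathList G l ∧ l ≠ [] ∧ l.length = n := by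
  obtain ⟨v, hv⟩ := h
  obtain ⟨l, hl, rfl⟩ := isPathEndpoint_iff_list.1 hv
  exact ⟨v :: l, hl, by simp, by simp⟩

theorem IsPathList.reverse {l : List V} (h : IsPathList G l) : IsPathList G l.reverse := by
  refine ⟨?_, List.nodup_reverse.2 h.2⟩
  rw [List.isChain_reverse]
  exact h.1.imp fun a b hab => hab.symm

theorem IsPathList.map {H : SimpleGraph W} {f : V → W} (hf : Function.Injective f)
    (hadj : ∀ a b, G.Adj a b → H.Adj (f a) (f b)) {l : List V} (h : IsPathList G l) :
    IsPathList H (l.map f) := by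
  refine ⟨?_, h.2.map hf⟩
  rw [List.isChain_map]
  exact h.1.imp fun a b hab => hadj a b hab

theorem IsPathEndpoint.map {H : SimpleGraph W} {f : V → W} (hf : Function.Injective f)
    (hadj : ∀ a b, G.Adj a b → H.Adj (f a) (f b)) (h : IsPathEndpoint G v n) :
    IsPathEndpoint H (f v) n := by
  rw [isPathEndpoint_iff_list] at h ⊢
  obtain ⟨l, hl, rfl⟩ := h
  exact ⟨l.map f, by simpa using hl.map hf hadj, by simp⟩

theorem HasNPath.map {H : SimpleGraph W} {f : V → W} (hf : Function.Injective f)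
    (hadj : ∀ a b, G.Adj a b → H.Adj (f a) (f b)) (h : HasNPath G n) : HasNPath H n := by
  obtain ⟨v, hv⟩ := h
  exact ⟨f v, IsPathEndpoint.map hf hadj hv⟩

theorem IsPathEndpoint.mono {m : ℕ} (h : IsPathEndpoint G v n) (hm : 1 ≤ m) (hmn : m ≤ n) :
    IsPathEndpoint G v m := by
  rw [isPathEndpoint_iff_list] at h ⊢
  obtain ⟨l, hl, rfl⟩ := h
  refine ⟨l.take (m - 1), ⟨?_, ?_⟩, by simp; omega⟩
  · simpa [List.take_succ_cons] using hl.1.take (m - 1 + 1)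
  · exact hl.2.sublist (by simpa using List.take_sublist _ _)

theorem HasNPath.mono {m : ℕ} (h : HasNPath G n) (hm : 1 ≤ m) (hmn : m ≤ n) : HasNPath G m := by
  obtain ⟨v, hv⟩ := h
  exact ⟨v, IsPathEndpoint.mono hv hm hmn⟩

theorem isPathEndpoint_one : IsPathEndpoint G v 1 :=
  ⟨v, Walk.nil, by simp, by simp⟩

theorem isPathEndpoint_two (h : G.Adj v u) : IsPathEndpoint G v 2 :=
  isPathEndpoint_iff_list.2 ⟨[u], ⟨by simpa using h, by simpa using h.ne⟩, by simp⟩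

theorem IsPathList.join {l₁ l₂ : List V} (h₁ : IsPathList G (v :: l₁)) (h₂ : IsPathList G (v :: l₂))
    (hd : l₁.Disjoint l₂) : HasNPath G (l₁.length + l₂.length + 1) := by
  have h : IsPathList G (l₁.reverse ++ v :: l₂) := by
    refine ⟨?_, ?_⟩
    · have h := h₁.reverse.1
      rw [List.reverse_cons] at h
      rw [List.isChain_split]
      exact ⟨h, h₂.1⟩
    · have a := h₁.2
      have b := h₂.2
      simp only [List.nodup_cons] at a b
      simp only [List.nodup_append', List.nodup_reverse, List.nodup_cons]
      refine ⟨a.2, b, ?_⟩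
      intro x hx hx'
      rw [List.mem_reverse] at hx
      rcases List.mem_cons.1 hx' with rfl | hx'
      · exact a.1 hx
      · exact hd hx hx'
  have := h.hasNPath (by simp)
  convert this using 1
  simp; omega

/-! ### Colorings -/

theorem GoodColoring.swap (h : GoodColoring G R k k) : GoodColoring G (G \ R) k k :=
  ⟨sdiff_le, h.2.2, by rw [sdiff_sdiff_eq_self h.1]; exact h.2.1⟩

/-! ### Adding a vertex -/

/-- The graph obtained from `G` by adding a new vertex adjacent to the vertices in `U`. -/
def cone (G : SimpleGraph V) (U : Set V) : SimpleGraph (Option V) where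
  Adj
    | some a, some b => G.Adj a b
    | none, some b => b ∈ U
    | some a, none => a ∈ U
    | none, none => False
  symm := ⟨by
    rintro (_ | a) (_ | b) h
    exacts [h, h, h, SimpleGraph.Adj.symm h]⟩
  loopless := ⟨by
    rintro (_ | a) h
    exacts [h, G.irrefl h]⟩

variable {U X : Set V}

@[simp] theorem cone_adj_some_some {a b : V} : (cone G U).Adj (some a) (some b) ↔ G.Adj a b :=
  Iff.rfl

@[simp] theorem cone_adj_none_some {b : V} : (cone G U).Adj none (some b) ↔ b ∈ U := Iff.rfl

@[simp] theorem cone_adj_some_none {b : V} : (cone G U).Adj (some b) none ↔ b ∈ U := Iff.rfl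

theorem exists_eq_cone (R : SimpleGraph (Option V)) : ∃ R' X, R = cone R' X := by
  refine ⟨R.comap some, {v | R.Adj none (some v)}, ?_⟩
  ext (_ | a) (_ | b)
  · simp
  · simp
  · simp [R.adj_comm]
  · simp

theorem cone_sdiff : cone G U \ cone R X = cone (G \ R) (U \ X) := by
  ext (_ | a) (_ | b) <;> simp

theorem cone_le_cone : cone R X ≤ cone G U ↔ R ≤ G ∧ X ⊆ U := by
  constructor
  · intro h
    exact ⟨fun a b hab => h (v := some a) (w := some b) hab,
      fun a ha => h (v := none) (w := some a) ha⟩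
  · rintro ⟨h, h'⟩ (_ | a) (_ | b) hab
    exacts [hab, h' hab, h' hab, h hab]

theorem IsPathEndpoint.cone (h : IsPathEndpoint G v n) (U : Set V) :
    IsPathEndpoint (cone G U) (some v) n :=
  h.map (Option.some_injective V) fun _ _ => id

theorem HasNPath.cone (h : HasNPath G n) (U : Set V) : HasNPath (cone G U) n :=
  h.map (Option.some_injective V) fun _ _ => id

theorem GoodColoring.of_cone (h : GoodColoring (cone G U) (cone R X) k k) :
    GoodColoring G R k k ∧ X ⊆ U := by
  obtain ⟨h₁, h₂, h₃⟩ := h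
  rw [cone_sdiff] at h₃
  rw [cone_le_cone] at h₁
  exact ⟨⟨h₁.1, fun h => h₂ (h.cone X), fun h => h₃ (h.cone _)⟩, h₁.2⟩

theorem exists_map_some {l : List (Option V)} (h : none ∉ l) : ∃ l' : List V, l = l'.map some := by
  refine ⟨l.reduceOption, ?_⟩
  induction l with
  | nil => rfl
  | cons a l ih =>
    cases a with
    | none => simp at h
    | some a =>
      rw [List.mem_cons, not_or] at h
      rw [List.reduceOption_cons_of_some, List.map_cons, ← ih h.2]

theorem isPathList_map_some {l : List V} : IsPathList (cone G U) (l.map some) ↔ IsPathList G l := by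
  unfold IsPathList
  rw [List.isChain_map, List.nodup_map_iff (Option.some_injective V)]
  rfl

theorem isPathEndpoint_cone_none (hn : 1 ≤ n) :
    IsPathEndpoint (cone G U) none (n + 1) ↔ ∃ v ∈ U, IsPathEndpoint G v n := by
  constructor
  · intro h
    obtain ⟨l, ⟨hc, hd⟩, hl⟩ := isPathEndpoint_iff_list.1 h
    rw [List.nodup_cons] at hd
    obtain ⟨l, rfl⟩ := exists_map_some hd.1
    cases l with
    | nil => simp at hl; omega
    | cons v l =>
      rw [List.map_cons, List.isChain_cons_cons] at hc
      refine ⟨v, hc.1, isPathEndpoint_iff_list.2 ⟨l, ?_, by simpa using hl⟩⟩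
      exact (isPathList_map_some (U := U)).1 ⟨hc.2, hd.2⟩
  · rintro ⟨v, hv, hv'⟩
    obtain ⟨l, h, rfl⟩ := isPathEndpoint_iff_list.1 hv'
    have h' := (isPathList_map_some (U := U)).2 h
    refine isPathEndpoint_iff_list.2 ⟨(v :: l).map some, ⟨?_, ?_⟩, by simp⟩
    · rw [List.map_cons, List.isChain_cons_cons]
      exact ⟨hv, h'.1⟩
    · rw [List.nodup_cons]
      exact ⟨by simp, h'.2⟩

theorem HasNPath.of_cone (hU : U.Subsingleton) (h : HasNPath (_root_.cone G U) n) :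
    HasNPath G n ∨ IsPathEndpoint (_root_.cone G U) none n := by
  obtain ⟨l, hl, hne, rfl⟩ := h.exists_list
  by_cases hm : none ∈ l
  · right
    obtain ⟨l₁, l₂, rfl⟩ := List.append_of_mem hm
    rcases l₁.eq_nil_or_concat with rfl | ⟨l₁, a, rfl⟩
    · exact isPathEndpoint_iff_list.2 ⟨l₂, hl, by simp⟩
    · cases l₂ with
      | nil =>
        refine isPathEndpoint_iff_list.2 ⟨(l₁ ++ [a]).reverse, ?_, by simp⟩
        simpa using hl.reverse
      | cons b l₂ =>
        exfalso
        have hab : a ≠ b := by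
          rintro rfl
          simpa [List.nodup_append] using hl.2
        have h1 : (_root_.cone G U).Adj a none ∧ (_root_.cone G U).Adj none b := by
          have := hl.1
          rw [List.concat_eq_append, List.append_assoc, List.singleton_append,
            List.isChain_append_cons_cons, List.isChain_cons_cons] at this
          exact ⟨this.2.1, this.2.2.1⟩
        cases a with
        | none => exact h1.1
        | some a =>
          cases b with
          | none => exact h1.2
          | some b => exact hab (congrArg some (hU h1.1 h1.2))
  · left
    obtain ⟨l, rfl⟩ := exists_map_some hm
    have := (isPathList_map_some.1 hl).hasNPath (by simpa using hne)
    simpa using this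

/-- A monochromatic path with `k` vertices in a cone over at most one vertex extends a path from
that vertex. -/
theorem not_hasNPath_cone (hk : 2 ≤ k) (hU : U.Subsingleton) (hG : ¬ HasNPath G k)
    (h : ∀ v ∈ U, ¬ IsPathEndpoint G v (k - 1)) : ¬ HasNPath (cone G U) k := by
  intro hc
  rcases hc.of_cone hU with h' | h'
  · exact hG h'
  · obtain ⟨m, rfl⟩ : ∃ m, k = m + 1 := ⟨k - 1, by omega⟩
    obtain ⟨v, hv, hp⟩ := (isPathEndpoint_cone_none (by omega)).1 h'
    exact h v hv hp

/-! ### Disjoint unions -/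

variable {G₁ R₁ : SimpleGraph V} {G₂ R₂ : SimpleGraph W} {a b d₁ d₂ : ℕ} {u₁ : V} {u₂ : W}

theorem sum_sdiff_sum : (G₁ ⊕g G₂) \ (R₁ ⊕g R₂) = (G₁ \ R₁) ⊕g (G₂ \ R₂) := by
  ext (a | a) (b | b) <;> simp

theorem exists_eq_sum {R : SimpleGraph (V ⊕ W)} (h : R ≤ G₁ ⊕g G₂) : ∃ R₁ R₂, R = R₁ ⊕g R₂ := by
  refine ⟨R.comap Sum.inl, R.comap Sum.inr, ?_⟩
  ext (a | a) (b | b)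
  · simp
  · simpa using fun hab => by simpa using h hab
  · simpa using fun hab => by simpa using h hab
  · simp

theorem sum_le_sum_iff : R₁ ⊕g R₂ ≤ G₁ ⊕g G₂ ↔ R₁ ≤ G₁ ∧ R₂ ≤ G₂ := by
  constructor
  · intro h
    exact ⟨fun a b hab => h (v := .inl a) (w := .inl b) hab,
      fun a b hab => h (v := .inr a) (w := .inr b) hab⟩
  · rintro ⟨h, h'⟩ (a | a) (b | b) hab
    exacts [h hab, hab, hab, h' hab]

theorem IsPathEndpoint.sum_inl (h : IsPathEndpoint G₁ u₁ n) (G₂ : SimpleGraph W) :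
    IsPathEndpoint (G₁ ⊕g G₂) (.inl u₁) n :=
  h.map Sum.inl_injective fun _ _ => id

theorem IsPathEndpoint.sum_inr (h : IsPathEndpoint G₂ u₂ n) (G₁ : SimpleGraph V) :
    IsPathEndpoint (G₁ ⊕g G₂) (.inr u₂) n :=
  h.map Sum.inr_injective fun _ _ => id

theorem HasNPath.sum_inl (h : HasNPath G₁ n) (G₂ : SimpleGraph W) : HasNPath (G₁ ⊕g G₂) n :=
  h.map Sum.inl_injective fun _ _ => id

theorem HasNPath.sum_inr (h : HasNPath G₂ n) (G₁ : SimpleGraph V) : HasNPath (G₁ ⊕g G₂) n :=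
  h.map Sum.inr_injective fun _ _ => id

theorem exists_map_inl {l : List (V ⊕ W)} (h : (Sum.inl u₁ :: l).IsChain (G₁ ⊕g G₂).Adj) :
    ∃ l' : List V, l = l'.map Sum.inl := by
  induction l generalizing u₁ with
  | nil => exact ⟨[], rfl⟩
  | cons x l ih =>
    rw [List.isChain_cons_cons] at h
    cases x with
    | inl x =>
      obtain ⟨l', rfl⟩ := ih h.2
      exact ⟨x :: l', rfl⟩
    | inr x => exact absurd h.1 (by simp)

theorem isPathEndpoint_sum_inl :
    IsPathEndpoint (G₁ ⊕g G₂) (.inl u₁) n ↔ IsPathEndpoint G₁ u₁ n := by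
  refine ⟨fun h => ?_, fun h => h.sum_inl G₂⟩
  obtain ⟨l, ⟨hc, hd⟩, rfl⟩ := isPathEndpoint_iff_list.1 h
  obtain ⟨l, rfl⟩ := exists_map_inl hc
  refine isPathEndpoint_iff_list.2 ⟨l, ⟨?_, ?_⟩, by simp⟩
  · rw [← List.map_cons, List.isChain_map] at hc
    exact hc
  · rw [← List.map_cons] at hd
    exact hd.of_map _

theorem isPathEndpoint_sum_inr :
    IsPathEndpoint (G₁ ⊕g G₂) (.inr u₂) n ↔ IsPathEndpoint G₂ u₂ n := by
  refine ⟨fun h => ?_, fun h => h.sum_inr G₁⟩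
  have h' : IsPathEndpoint (G₂ ⊕g G₁) (.inl u₂) n :=
    h.map (f := Sum.swap) Sum.swap_leftInverse.injective
      (by rintro (a | a) (b | b) hab <;> exact hab)
  exact isPathEndpoint_sum_inl.1 h'

theorem hasNPath_sum : HasNPath (G₁ ⊕g G₂) n ↔ HasNPath G₁ n ∨ HasNPath G₂ n := by
  constructor
  · rintro ⟨u | u, h⟩
    · exact Or.inl ⟨u, isPathEndpoint_sum_inl.1 h⟩
    · exact Or.inr ⟨u, isPathEndpoint_sum_inr.1 h⟩
  · rintro (h | h)
    exacts [h.sum_inl _, h.sum_inr _]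

theorem GoodColoring.of_sum (h : GoodColoring (G₁ ⊕g G₂) (R₁ ⊕g R₂) k k) :
    GoodColoring G₁ R₁ k k ∧ GoodColoring G₂ R₂ k k := by
  obtain ⟨h₁, h₂, h₃⟩ := h
  rw [sum_sdiff_sum, hasNPath_sum, not_or] at h₃
  rw [hasNPath_sum, not_or] at h₂
  rw [sum_le_sum_iff] at h₁
  exact ⟨⟨h₁.1, h₂.1, h₃.1⟩, ⟨h₁.2, h₂.2, h₃.2⟩⟩

theorem hasNPath_cone_sum {U : Set (V ⊕ W)} (h₁ : IsPathEndpoint G₁ u₁ a)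
    (h₂ : IsPathEndpoint G₂ u₂ b) (hu₁ : .inl u₁ ∈ U) (hu₂ : .inr u₂ ∈ U) :
    HasNPath (cone (G₁ ⊕g G₂) U) (a + b + 1) := by
  obtain ⟨l₁, hl₁, rfl⟩ := isPathEndpoint_iff_list.1 h₁
  obtain ⟨l₂, hl₂, rfl⟩ := isPathEndpoint_iff_list.1 h₂
  have e₁ : IsPathList (cone (G₁ ⊕g G₂) U) (((u₁ :: l₁).map Sum.inl).map some) :=
    isPathList_map_some.2 (hl₁.map Sum.inl_injective fun _ _ => id)
  have e₂ : IsPathList (cone (G₁ ⊕g G₂) U) (((u₂ :: l₂).map Sum.inr).map some) :=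
    isPathList_map_some.2 (hl₂.map Sum.inr_injective fun _ _ => id)
  have f₁ : IsPathList (cone (G₁ ⊕g G₂) U) (none :: ((u₁ :: l₁).map Sum.inl).map some) :=
    ⟨List.isChain_cons_cons.2 ⟨hu₁, e₁.1⟩, List.nodup_cons.2 ⟨by simp, e₁.2⟩⟩
  have f₂ : IsPathList (cone (G₁ ⊕g G₂) U) (none :: ((u₂ :: l₂).map Sum.inr).map some) :=
    ⟨List.isChain_cons_cons.2 ⟨hu₂, e₂.1⟩, List.nodup_cons.2 ⟨by simp, e₂.2⟩⟩
  have := f₁.join f₂ (by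
    intro x hx hx'
    simp only [List.map_map, List.mem_map, Function.comp_apply] at hx hx'
    obtain ⟨y, -, rfl⟩ := hx
    obtain ⟨z, -, hz⟩ := hx'
    simp at hz)
  simpa using this

/-! ### Vertices that end long paths in both colors -/

/-- In every good coloring of `G`, the vertex `u` is an endpoint of a red path and, by symmetry, of
a blue path on `d` vertices, and in some good coloring the bound is sharp for one of the colors. -/
structure BothForced (k d : ℕ) (G : SimpleGraph V) (u : V) : Prop where
  endpoint : ∀ R, GoodColoring G R k k → IsPathEndpoint R u d
  sharp : ∃ R, GoodColoring G R k k ∧ ¬ IsPathEndpoint R u (d + 1)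

theorem GoodColoring.cone_sum_cases {R : SimpleGraph (Option (V ⊕ W))} {U : Set (V ⊕ W)}
    (h : GoodColoring (cone (G₁ ⊕g G₂) U) R k k) :
    ∃ R₁ R₂ X, R = cone (R₁ ⊕g R₂) X ∧ X ⊆ U ∧ GoodColoring G₁ R₁ k k ∧ GoodColoring G₂ R₂ k k ∧
      cone (G₁ ⊕g G₂) U \ R = cone ((G₁ \ R₁) ⊕g (G₂ \ R₂)) (U \ X) := by
  obtain ⟨R', X, rfl⟩ := exists_eq_cone R
  obtain ⟨h', hX⟩ := h.of_cone
  obtain ⟨R₁, R₂, rfl⟩ := exists_eq_sum h'.1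
  obtain ⟨h₁, h₂⟩ := h'.of_sum
  exact ⟨R₁, R₂, X, rfl, hX, h₁, h₂, by rw [cone_sdiff, sum_sdiff_sum]⟩

/-- Coloring the two edges at the apex differently preserves goodness when the paths they
extend are short. -/
theorem goodColoring_cone_sum (hk : 2 ≤ k) (h₁ : GoodColoring G₁ R₁ k k)
    (h₂ : GoodColoring G₂ R₂ k k) (hu₁ : ¬ IsPathEndpoint R₁ u₁ (k - 1))
    (hu₂ : ¬ IsPathEndpoint (G₂ \ R₂) u₂ (k - 1)) :
    GoodColoring (cone (G₁ ⊕g G₂) {.inl u₁, .inr u₂}) (cone (R₁ ⊕g R₂) {.inl u₁}) k k := by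
  refine ⟨cone_le_cone.2 ⟨sum_le_sum_iff.2 ⟨h₁.1, h₂.1⟩, by simp⟩, ?_, ?_⟩
  · refine not_hasNPath_cone hk Set.subsingleton_singleton ?_ ?_
    · rw [hasNPath_sum, not_or]
      exact ⟨h₁.2.1, h₂.2.1⟩
    · rintro _ rfl
      rwa [isPathEndpoint_sum_inl]
  · have hU : ({.inl u₁, .inr u₂} : Set (V ⊕ W)) \ {.inl u₁} = {.inr u₂} := by
      ext (x | x) <;> simp
    rw [cone_sdiff, sum_sdiff_sum, hU]
    refine not_hasNPath_cone hk Set.subsingleton_singleton ?_ ?_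
    · rw [hasNPath_sum, not_or]
      exact ⟨h₁.2.2, h₂.2.2⟩
    · rintro _ rfl
      rwa [isPathEndpoint_sum_inr]

theorem BothForced.cone_sum (h₁ : BothForced k d₁ G₁ u₁) (h₂ : BothForced k d₂ G₂ u₂)
    (hd₁ : 1 ≤ d₁) (hd : d₁ ≤ d₂) (hk : k ≤ d₁ + d₂ + 1) (hk' : d₂ + 2 ≤ k) :
    BothForced k (d₁ + 1) (cone (G₁ ⊕g G₂) {.inl u₁, .inr u₂}) none := by
  constructor
  · intro R hR
    obtain ⟨R₁, R₂, X, rfl, hX, hR₁, hR₂, hs⟩ := hR.cone_sum_cases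
    by_cases hu₁ : .inl u₁ ∈ X
    · exact (isPathEndpoint_cone_none hd₁).2 ⟨_, hu₁, (h₁.endpoint _ hR₁).sum_inl _⟩
    · by_cases hu₂ : .inr u₂ ∈ X
      · exact ((isPathEndpoint_cone_none (hd₁.trans hd)).2
          ⟨_, hu₂, (h₂.endpoint _ hR₂).sum_inr _⟩).mono (by omega) (by omega)
      · refine absurd ?_ hR.2.2
        rw [hs]
        exact (hasNPath_cone_sum (h₁.endpoint _ hR₁.swap) (h₂.endpoint _ hR₂.swap)
          (by simp [hu₁]) (by simp [hu₂])).mono (by omega) hk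
  · obtain ⟨R₁, hR₁, hu₁⟩ := h₁.sharp
    obtain ⟨R₂, hR₂, hu₂⟩ := h₂.sharp
    refine ⟨_, goodColoring_cone_sum (u₁ := u₁) (u₂ := u₂) (by omega) hR₁ hR₂.swap ?_ ?_, ?_⟩
    · exact fun h => hu₁ (h.mono (by omega) (by omega))
    · rw [sdiff_sdiff_eq_self hR₂.1]
      exact fun h => hu₂ (h.mono (by omega) (by omega))
    · rw [isPathEndpoint_cone_none (by omega)]
      rintro ⟨_, rfl, h⟩
      exact hu₁ (isPathEndpoint_sum_inl.1 h)

/-- Some finite graph has a vertex that is `BothForced`. -/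
def ExistsBothForced (k d : ℕ) : Prop :=
  ∃ (V : Type) (_ : Finite V) (G : SimpleGraph V) (u : V), BothForced k d G u

theorem ExistsBothForced.extend (h : ExistsBothForced k d) (hd : 1 ≤ d) (hdk : d + 2 ≤ k)
    (hk : k ≤ 2 * d + 1) : ExistsBothForced k (k - 2) := by
  obtain ⟨m, hm⟩ : ∃ m, k - 2 = d + m := ⟨k - 2 - d, by omega⟩
  induction m generalizing d with
  | zero => rwa [hm]
  | succ m ih =>
    refine ih (d := d + 1) ?_ (by omega) (by omega) (by omega) (by omega)
    obtain ⟨V, _, G, u, h⟩ := h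
    exact ⟨_, inferInstance, _, _, h.cone_sum h hd le_rfl (by omega) (by omega)⟩

/-! ### Transmitters -/

/-- Every good coloring makes `u` a strict endpoint of a path on `y` vertices in one color and
an endpoint of a path on `k - 1` vertices in the other color. -/
structure Saturated (k y : ℕ) (G : SimpleGraph V) (u : V) : Prop where
  isGood : IsGood G k k
  endpoint : ∀ R, GoodColoring G R k k →
    (StrictEndpoint R u y ∧ IsPathEndpoint (G \ R) u (k - 1)) ∨
    (StrictEndpoint (G \ R) u y ∧ IsPathEndpoint R u (k - 1))

/-- The defining property of a `(k, x)`-transmitter. -/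
structure Transmitter (k x : ℕ) (G : SimpleGraph V) (v : V) : Prop where
  isGood : IsGood G k k
  endpoint : ∀ R, GoodColoring G R k k →
    (StrictEndpoint R v x ∧ ∀ u, ¬ (G \ R).Adj v u) ∨
    (StrictEndpoint (G \ R) v x ∧ ∀ u, ¬ R.Adj v u)

theorem strictEndpoint_one (h : ∀ u, ¬ G.Adj v u) : StrictEndpoint G v 1 := by
  refine ⟨isPathEndpoint_one, fun y hy => ?_⟩
  obtain ⟨w, p, -, rfl⟩ := hy
  cases p with
  | nil => simp
  | cons hadj _ => exact absurd hadj (h _)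

theorem StrictEndpoint.one_le {y : ℕ} (h : StrictEndpoint G v y) : 1 ≤ y :=
  h.2 1 isPathEndpoint_one

theorem StrictEndpoint.cone {y : ℕ} (h : StrictEndpoint G u y) (hu : u ∈ X)
    (hX : X.Subsingleton) : StrictEndpoint (cone G X) none (y + 1) := by
  refine ⟨(isPathEndpoint_cone_none h.one_le).2 ⟨u, hu, h.1⟩, fun z hz => ?_⟩
  rcases Nat.lt_or_ge z 2 with hz' | hz'
  · omega
  · obtain ⟨m, rfl⟩ : ∃ m, z = m + 1 := ⟨z - 1, by omega⟩
    obtain ⟨v, hv, hp⟩ := (isPathEndpoint_cone_none (by omega)).1 hz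
    obtain rfl := hX hv hu
    have := h.2 m hp
    omega

theorem StrictEndpoint.sum_inl {y : ℕ} (h : StrictEndpoint G₁ u₁ y) (G₂ : SimpleGraph W) :
    StrictEndpoint (G₁ ⊕g G₂) (.inl u₁) y :=
  ⟨h.1.sum_inl _, fun z hz => h.2 z (isPathEndpoint_sum_inl.1 hz)⟩

/-- A good coloring extends to a pendant edge when the paths it prolongs are short. -/
theorem goodColoring_cone_singleton (hk : 2 ≤ k) (h : GoodColoring G R k k)
    (hu : ¬ IsPathEndpoint R u (k - 1)) : GoodColoring (cone G {u}) (cone R {u}) k k := by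
  refine ⟨cone_le_cone.2 ⟨h.1, le_rfl⟩, ?_, ?_⟩
  · refine not_hasNPath_cone hk Set.subsingleton_singleton h.2.1 ?_
    rintro _ rfl
    exact hu
  · rw [cone_sdiff, Set.sdiff_self]
    exact not_hasNPath_cone hk Set.subsingleton_empty h.2.2 (by simp)

theorem adj_or_sdiff_adj {a b : V} (h : G.Adj a b) : R.Adj a b ∨ (G \ R).Adj a b := by
  by_cases hR : R.Adj a b
  · exact Or.inl hR
  · exact Or.inr ⟨h, hR⟩

theorem GoodColoring.cone_singleton_cases {R : SimpleGraph (Option V)}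
    (h : GoodColoring (cone G {u}) R k k) (hu : R.Adj none (some u)) :
    ∃ R', R = cone R' {u} ∧ GoodColoring G R' k k ∧ cone G {u} \ R = cone (G \ R') ∅ := by
  obtain ⟨R', X, rfl⟩ := exists_eq_cone R
  obtain ⟨h', hX⟩ := h.of_cone
  obtain rfl : X = {u} := hX.antisymm (by simpa using hu)
  exact ⟨R', rfl, h', by rw [cone_sdiff, Set.sdiff_self]⟩

theorem cone_empty_not_adj (x : Option V) : ¬ (cone G ∅).Adj none x := by
  cases x with
  | none => exact id
  | some x => simp

theorem BothForced.saturated (h : BothForced k (k - 2) G u) (hk : 3 ≤ k) :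
    Saturated k 1 (cone G {u}) none := by
  have key : ∀ R, GoodColoring (cone G {u}) R k k → R.Adj none (some u) →
      StrictEndpoint (cone G {u} \ R) none 1 ∧ IsPathEndpoint R none (k - 1) := by
    intro R hR hu
    obtain ⟨R', rfl, hR', hs⟩ := hR.cone_singleton_cases hu
    rw [hs]
    refine ⟨strictEndpoint_one cone_empty_not_adj, ?_⟩
    obtain ⟨m, rfl⟩ : ∃ m, k = m + 2 := ⟨k - 2, by omega⟩
    exact (isPathEndpoint_cone_none (by omega)).2 ⟨u, rfl, h.endpoint _ hR'⟩
  constructor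
  · obtain ⟨R, hR, hu⟩ := h.sharp
    exact ⟨_, goodColoring_cone_singleton (by omega) hR
      fun h' => hu (h'.mono (by omega) (by omega))⟩
  · intro R hR
    rcases adj_or_sdiff_adj (R := R) (show (cone G {u}).Adj none (some u) by simp) with h' | h'
    · exact Or.inr (key R hR h')
    · have := key _ hR.swap h'
      rw [sdiff_sdiff_eq_self hR.1] at this
      exact Or.inl this

theorem Saturated.exists_coloring {y : ℕ} (h : Saturated k y G u) :
    ∃ R, GoodColoring G R k k ∧ StrictEndpoint R u y := by
  obtain ⟨R, hR⟩ := h.isGood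
  rcases h.endpoint R hR with h' | h'
  · exact ⟨R, hR, h'.1⟩
  · exact ⟨_, hR.swap, h'.1⟩

theorem Saturated.cone_sum {y : ℕ} (h₁ : Saturated k y G₁ u₁) (h₂ : BothForced k (k - 2) G₂ u₂)
    (hy : y + 3 ≤ k) : Saturated k (y + 1) (cone (G₁ ⊕g G₂) {.inl u₁, .inr u₂}) none := by
  have key : ∀ R, GoodColoring (cone (G₁ ⊕g G₂) {.inl u₁, .inr u₂}) R k k →
      R.Adj none (some (.inl u₁)) → StrictEndpoint R none (y + 1) ∧
        IsPathEndpoint (cone (G₁ ⊕g G₂) {.inl u₁, .inr u₂} \ R) none (k - 1) := by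
    intro R hR hu
    obtain ⟨R₁, R₂, X, rfl, hX, hR₁, hR₂, hs⟩ := hR.cone_sum_cases
    rw [cone_adj_none_some] at hu
    have hu₂ : .inr u₂ ∉ X := fun hu₂ => hR.2.1 <|
      (hasNPath_cone_sum isPathEndpoint_one (h₂.endpoint _ hR₂) hu hu₂).mono
        (by omega) (by omega)
    rw [hs]
    constructor
    · rcases h₁.endpoint _ hR₁ with h | h
      · refine (h.1.sum_inl _).cone hu ?_
        refine (Set.subsingleton_singleton (a := Sum.inl u₁)).anti fun x hx => ?_
        rcases hX hx with rfl | rfl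
        exacts [rfl, absurd hx hu₂]
      · exact absurd ⟨none, ((isPathEndpoint_cone_none (by omega)).2
          ⟨_, hu, h.2.sum_inl R₂⟩).mono (by omega) (by omega)⟩ hR.2.1
    · exact ((isPathEndpoint_cone_none (n := k - 2) (by omega)).2
        ⟨.inr u₂, by simp [hu₂], (h₂.endpoint _ hR₂.swap).sum_inr _⟩).mono (by omega) (by omega)
  constructor
  · obtain ⟨R₁, hR₁, hu₁⟩ := h₁.exists_coloring
    obtain ⟨R₂, hR₂, hu₂⟩ := h₂.sharp
    refine ⟨_, goodColoring_cone_sum (u₁ := u₁) (u₂ := u₂) (by omega) hR₁ hR₂.swap ?_ ?_⟩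
    · intro h
      have := hu₁.2 _ h
      omega
    · rw [sdiff_sdiff_eq_self hR₂.1]
      exact fun h => hu₂ (h.mono (by omega) (by omega))
  · intro R hR
    rcases adj_or_sdiff_adj (R := R) (show (cone (G₁ ⊕g G₂) {.inl u₁, .inr u₂}).Adj none
      (some (.inl u₁)) by simp) with h' | h'
    · exact Or.inl (key R hR h')
    · have := key _ hR.swap h'
      rw [sdiff_sdiff_eq_self hR.1] at this
      exact Or.inr this

theorem Saturated.transmitter {y : ℕ} (h : Saturated k y G u) (hy : y + 2 ≤ k) :
    Transmitter k (y + 1) (cone G {u}) none := by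
  have key : ∀ R, GoodColoring (cone G {u}) R k k → R.Adj none (some u) →
      StrictEndpoint R none (y + 1) ∧ ∀ x, ¬ (cone G {u} \ R).Adj none x := by
    intro R hR hu
    obtain ⟨R', rfl, hR', hs⟩ := hR.cone_singleton_cases hu
    rw [hs]
    refine ⟨?_, cone_empty_not_adj⟩
    rcases h.endpoint _ hR' with h | h
    · exact h.1.cone rfl Set.subsingleton_singleton
    · have h' : IsPathEndpoint (_root_.cone R' {u}) none k :=
        ((isPathEndpoint_cone_none (n := k - 1) (by omega)).2 ⟨u, Set.mem_singleton u, h.2⟩).mono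
          (by omega) (by omega)
      exact absurd ⟨none, h'⟩ hR.2.1
  constructor
  · obtain ⟨R, hR, hu⟩ := h.exists_coloring
    refine ⟨_, goodColoring_cone_singleton (by omega) hR fun h' => ?_⟩
    have := hu.2 _ h'
    omega
  · intro R hR
    rcases adj_or_sdiff_adj (R := R) (show (cone G {u}).Adj none (some u) by simp) with h' | h'
    · exact Or.inl (key R hR h')
    · have := key _ hR.swap h'
      rw [sdiff_sdiff_eq_self hR.1] at this
      exact Or.inr this

theorem ExistsBothForced.exists_saturated (h : ExistsBothForced k (k - 2)) {y : ℕ} (hy : 1 ≤ y)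
    (hyk : y + 2 ≤ k) :
    ∃ (V : Type) (_ : Finite V) (G : SimpleGraph V) (u : V), Saturated k y G u := by
  obtain ⟨V, _, G, u, h⟩ := h
  induction y, hy using Nat.le_induction with
  | base => exact ⟨_, inferInstance, _, _, h.saturated (by omega)⟩
  | succ y hy ih =>
    obtain ⟨V', _, G', u', h'⟩ := ih (by omega)
    exact ⟨_, inferInstance, _, _, h'.cone_sum h (by omega)⟩

theorem IsPathEndpoint.comap_equiv (e : V ≃ W) {H : SimpleGraph W} :
    IsPathEndpoint (H.comap e) v n ↔ IsPathEndpoint H (e v) n := by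
  refine ⟨fun h => h.map e.injective fun _ _ => id, fun h => ?_⟩
  simpa using h.map (H := H.comap e) e.symm.injective (by simp)

theorem HasNPath.comap_equiv (e : V ≃ W) {H : SimpleGraph W} :
    HasNPath (H.comap e) n ↔ HasNPath H n := by
  refine ⟨fun h => h.map e.injective fun _ _ => id, fun h => ?_⟩
  exact h.map (H := H.comap e) e.symm.injective (by simp)

theorem GoodColoring.comap_equiv (e : V ≃ W) {H R : SimpleGraph W} (h : GoodColoring H R k k) :
    GoodColoring (H.comap e) (R.comap e) k k :=
  ⟨fun _ _ hab => h.1 hab, by rw [HasNPath.comap_equiv]; exact h.2.1,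
    by rw [show H.comap e \ R.comap e = (H \ R).comap e from rfl, HasNPath.comap_equiv]
       exact h.2.2⟩

theorem StrictEndpoint.comap_equiv (e : V ≃ W) {H : SimpleGraph W} :
    StrictEndpoint (H.comap e) v n ↔ StrictEndpoint H (e v) n := by
  simp only [StrictEndpoint, IsPathEndpoint.comap_equiv]

theorem Transmitter.comap_equiv {x : ℕ} (h : Transmitter k x G v) (e : W ≃ V) :
    Transmitter k x (G.comap e) (e.symm v) := by
  constructor
  · obtain ⟨R, hR⟩ := h.isGood
    exact ⟨_, hR.comap_equiv e⟩
  · intro R hR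
    have hR' : GoodColoring G (R.comap e.symm) k k := by
      have := hR.comap_equiv e.symm
      rwa [show (G.comap e).comap e.symm = G by ext; simp] at this
    have hs : G \ R.comap e.symm = (G.comap e \ R).comap e.symm := by ext; simp
    have := h.endpoint _ hR'
    rw [hs, StrictEndpoint.comap_equiv, StrictEndpoint.comap_equiv] at this
    refine this.imp (And.imp_right fun h u => ?_) (And.imp_right fun h u => ?_)
    · simpa using h (e u)
    · simpa using h (e u)

/-! ### Small cases -/

theorem existsBothForced_three : ExistsBothForced 3 1 := by
  have h : ∀ n, HasNPath (⊥ : SimpleGraph Unit) n → n ≤ 1 := by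
    rintro n ⟨u, w, p, -, rfl⟩
    cases p with
    | nil => simp
    | cons h _ => exact h.elim
  refine ⟨Unit, inferInstance, ⊥, (), fun R _ => isPathEndpoint_one, ⊥, ⟨le_rfl, ?_, ?_⟩, ?_⟩
  · intro h'
    have := h _ h'
    omega
  · intro h'
    rw [sdiff_bot] at h'
    have := h _ h'
    omega
  · intro h'
    have := h _ ⟨_, h'⟩
    omega

theorem IsPathEndpoint.exists_three (h : IsPathEndpoint G v 3) :
    ∃ b c, G.Adj v b ∧ G.Adj b c ∧ v ≠ c := by
  obtain ⟨l, hl, h⟩ := isPathEndpoint_iff_list.1 h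
  match l, h with
  | [b, c], _ =>
    have h₁ := hl.1
    have h₂ := hl.2
    simp only [List.isChain_cons_cons, List.nodup_cons, List.mem_cons] at h₁ h₂
    exact ⟨b, c, h₁.1, h₁.2.1, by tauto⟩

theorem hasNPath_four : HasNPath G 4 ↔
    ∃ a b, G.Adj a b ∧ ∃ c, G.Adj b c ∧ ∃ d, G.Adj c d ∧ [a, b, c, d].Nodup := by
  constructor
  · intro h
    obtain ⟨l, ⟨hc, hn⟩, -, h⟩ := h.exists_list
    match l, h with
    | [a, b, c, d], _ =>
      simp only [List.isChain_cons_cons] at hc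
      exact ⟨a, b, hc.1, c, hc.2.1, d, hc.2.2.1, hn⟩
  · rintro ⟨a, b, h₁, c, h₂, d, h₃, hn⟩
    exact IsPathList.hasNPath (l := [a, b, c, d]) ⟨by simp [*], hn⟩ (by simp)

theorem not_hasNPath_four (h : ¬ HasNPath G 4) (a b c d : V) (hn : [a, b, c, d].Nodup) :
    G.Adj a b → G.Adj b c → G.Adj c d → False :=
  fun h₁ h₂ h₃ => h (hasNPath_four.2 ⟨a, b, h₁, c, h₂, d, h₃, hn⟩)

theorem hasNPath_five : HasNPath G 5 ↔
    ∃ a b, G.Adj a b ∧ ∃ c, G.Adj b c ∧ ∃ d, G.Adj c d ∧ ∃ e, G.Adj d e ∧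
      [a, b, c, d, e].Nodup := by
  constructor
  · intro h
    obtain ⟨l, ⟨hc, hn⟩, -, h⟩ := h.exists_list
    match l, h with
    | [a, b, c, d, e], _ =>
      simp only [List.isChain_cons_cons] at hc
      exact ⟨a, b, hc.1, c, hc.2.1, d, hc.2.2.1, e, hc.2.2.2.1, hn⟩
  · rintro ⟨a, b, h₁, c, h₂, d, h₃, e, h₄, hn⟩
    exact IsPathList.hasNPath (l := [a, b, c, d, e]) ⟨by simp [*], hn⟩ (by simp)

theorem not_hasNPath_five (h : ¬ HasNPath G 5) (a b c d e : V) (hn : [a, b, c, d, e].Nodup) :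
    G.Adj a b → G.Adj b c → G.Adj c d → G.Adj d e → False :=
  fun h₁ h₂ h₃ h₄ => h (hasNPath_five.2 ⟨a, b, h₁, c, h₂, d, h₃, e, h₄, hn⟩)

/-- The graph on `Fin n` with the given list of edges. -/
def ofEdges (l : List (Fin n × Fin n)) : SimpleGraph (Fin n) where
  Adj a b := a ≠ b ∧ ((a, b) ∈ l ∨ (b, a) ∈ l)
  symm := ⟨fun _ _ h => ⟨h.1.symm, h.2.symm⟩⟩
  loopless := ⟨fun _ h => h.1 rfl⟩

instance (l : List (Fin n × Fin n)) : DecidableRel (ofEdges l).Adj :=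
  fun a b => inferInstanceAs (Decidable (a ≠ b ∧ ((a, b) ∈ l ∨ (b, a) ∈ l)))

/-- A square with a pendant edge. -/
abbrev squareWithPendant : SimpleGraph (Fin 5) :=
  ofEdges [(0, 1), (0, 2), (1, 3), (2, 3), (1, 4)]

theorem existsBothForced_four : ExistsBothForced 4 2 := by
  refine ⟨Fin 5, inferInstance, squareWithPendant, 0, fun S hS => ?_,
    ofEdges [(0, 1), (2, 3)], ⟨?_, ?_, ?_⟩, ?_⟩
  · obtain ⟨-, h₁, h₂⟩ := hS
    by_contra hc
    have b : ∀ a b, squareWithPendant.Adj a b → S.Adj a b ∨ (squareWithPendant \ S).Adj a b :=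
      fun a b => adj_or_sdiff_adj
    have e : ∀ a, squareWithPendant.Adj 0 a → (squareWithPendant \ S).Adj 0 a :=
      fun a h => ⟨h, fun h => hc (isPathEndpoint_two h)⟩
    have p₁ := not_hasNPath_four h₁
    have p₂ := not_hasNPath_four h₂
    have h01 := e 1 (by decide)
    have h02 := e 2 (by decide)
    have h13 := (b 1 3 (by decide)).resolve_right fun h =>
      p₂ 3 1 0 2 (by decide) h.symm h01.symm h02
    have h23 := (b 2 3 (by decide)).resolve_right fun h =>
      p₂ 3 2 0 1 (by decide) h.symm h02.symm h01
    rcases b 1 4 (by decide) with h | h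
    · exact p₁ 4 1 3 2 (by decide) h.symm h13 h23.symm
    · exact p₂ 4 1 0 2 (by decide) h.symm h01.symm h02
  · intro a b
    revert a b
    decide
  · rw [hasNPath_four]
    decide
  · rw [hasNPath_four]
    decide
  · intro h
    have := IsPathEndpoint.exists_three h
    revert this
    decide

/-- A hexagon with a vertex joined to every second vertex. -/
abbrev hexagonWithCenter : SimpleGraph (Fin 7) :=
  ofEdges [(0, 1), (0, 2), (0, 3), (1, 5), (1, 6), (2, 4), (2, 6), (3, 4), (3, 5)]

theorem existsBothForced_five : ExistsBothForced 5 2 := by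
  refine ⟨Fin 7, inferInstance, hexagonWithCenter,
    0, fun S hS => ?_, ofEdges [(0, 1), (2, 4), (2, 6), (3, 5)], ⟨?_, ?_, ?_⟩, ?_⟩
  · obtain ⟨-, h₁, h₂⟩ := hS
    by_contra hc
    have b : ∀ a b, hexagonWithCenter.Adj a b → S.Adj a b ∨ (hexagonWithCenter \ S).Adj a b :=
      fun a b => adj_or_sdiff_adj
    have e : ∀ a, hexagonWithCenter.Adj 0 a → (hexagonWithCenter \ S).Adj 0 a :=
      fun a h => ⟨h, fun h => hc (isPathEndpoint_two h)⟩
    have h01 := e 1 (by decide)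
    have h02 := e 2 (by decide)
    have h03 := e 3 (by decide)
    have b15 := b 1 5 (by decide)
    have b16 := b 1 6 (by decide)
    have b24 := b 2 4 (by decide)
    have b26 := b 2 6 (by decide)
    have b34 := b 3 4 (by decide)
    have b35 := b 3 5 (by decide)
    have p₁ := not_hasNPath_five h₁
    have p₂ := not_hasNPath_five h₂
    have := p₁ 4 3 5 1 6 (by decide)
    have := p₁ 4 2 6 1 5 (by decide)
    have := p₁ 5 3 4 2 6 (by decide)
    have := p₁ 1 5 3 4 2 (by decide)
    have := p₂ 4 2 0 1 6 (by decide)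
    have := p₂ 4 3 0 2 6 (by decide)
    have := p₂ 5 3 0 2 6 (by decide)
    have := p₂ 5 3 0 1 6 (by decide)
    have := p₂ 2 0 1 5 3 (by decide)
    have := p₂ 4 3 0 1 5 (by decide)
    have := p₂ 5 1 0 2 6 (by decide)
    have := p₂ 4 3 0 1 6 (by decide)
    have := p₂ 1 0 3 4 2 (by decide)
    have := p₂ 4 2 0 1 5 (by decide)
    have := p₂ 4 2 0 3 5 (by decide)
    clear p₁ p₂ h₁ h₂ b e hc
    generalize hexagonWithCenter \ S = B at *
    grind [SimpleGraph.adj_comm]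
  · intro a b
    revert a b
    decide
  · rw [hasNPath_five]
    decide
  · rw [hasNPath_five]
    decide
  · intro h
    have := IsPathEndpoint.exists_three h
    revert this
    decide

/-! ### Paths in complete bipartite subgraphs and paths with small vertex covers -/

section Bipartite

open Finset

variable [DecidableEq V]

theorem exists_isPathList_of_complete {s : ℕ} (hs : 1 ≤ s) {X Y : Finset V} (hX : #X = s)
    (hY : s ≤ #Y) (hXY : Disjoint X Y) (hG : ∀ x ∈ X, ∀ y ∈ Y, G.Adj x y) {x : V} (hx : x ∈ X) :
    ∃ l, IsPathList G (x :: l) ∧ l.length + 1 = 2 * s ∧ ∀ z ∈ l, z ∈ X ∨ z ∈ Y := by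
  induction s, hs using Nat.le_induction generalizing X Y x with
  | base =>
    obtain ⟨y, hy⟩ := Finset.card_pos.1 hY
    have hxy := hG x hx y hy
    exact ⟨[y], ⟨by simpa using hxy, by simpa using hxy.ne⟩, by simp, by simp [hy]⟩
  | succ s hs ih =>
    obtain ⟨y, hy⟩ := Finset.card_pos.1 (show 0 < #Y by omega)
    have hX' : #(X.erase x) = s := by rw [card_erase_of_mem hx]; omega
    have hY' : s ≤ #(Y.erase y) := by rw [card_erase_of_mem hy]; omega
    obtain ⟨x', hx'⟩ := Finset.card_pos.1 (show 0 < #(X.erase x) by omega)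
    obtain ⟨l, hl, hlen, hmem⟩ := ih hX' hY'
      (hXY.mono (erase_subset _ _) (erase_subset _ _))
      (fun a ha b hb => hG a (mem_of_mem_erase ha) b (mem_of_mem_erase hb)) hx'
    have hmem' : ∀ z ∈ x' :: l, z ∈ X.erase x ∨ z ∈ Y.erase y := by
      intro z hz
      rcases List.mem_cons.1 hz with rfl | hz
      exacts [Or.inl hx', hmem z hz]
    have hne : ∀ a ∈ X, ∀ b ∈ Y, a ≠ b := fun a ha b hb => (hG a ha b hb).ne
    refine ⟨y :: x' :: l, ⟨?_, ?_⟩, by simp only [List.length_cons]; omega, ?_⟩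
    · rw [List.isChain_cons_cons, List.isChain_cons_cons]
      exact ⟨hG x hx y hy, (hG x' (mem_of_mem_erase hx') y hy).symm, hl.1⟩
    · rw [List.nodup_cons, List.nodup_cons]
      refine ⟨fun h => ?_, fun h => ?_, hl.2⟩
      · rcases List.mem_cons.1 h with h | h
        · exact hne x hx y hy h
        · rcases hmem' x h with h | h
          · simp at h
          · exact hne x hx x (mem_of_mem_erase h) rfl
      · rcases hmem' y h with h | h
        · exact hne y (mem_of_mem_erase h) y hy rfl
        · simp at h
    · intro z hz
      rcases List.mem_cons.1 hz with rfl | hz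
      · exact Or.inr hy
      · exact (hmem' z hz).imp mem_of_mem_erase mem_of_mem_erase

theorem hasNPath_of_complete {s : ℕ} {X Y : Finset V} (hX : s + 1 ≤ #X) (hY : s + 2 ≤ #Y)
    (hXY : Disjoint X Y) (hG : ∀ x ∈ X, ∀ y ∈ Y, G.Adj x y) : HasNPath G (2 * s + 3) := by
  obtain ⟨X', hX', hcard⟩ := exists_subset_card_eq hX
  obtain ⟨x, hx⟩ := Finset.card_pos.1 (show 0 < #X' by omega)
  obtain ⟨y, hy⟩ := Finset.card_pos.1 (show 0 < #Y by omega)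
  have hxy := hG x (hX' hx) y hy
  obtain ⟨l, hl, hlen, hmem⟩ := exists_isPathList_of_complete (by omega) hcard
    (show s + 1 ≤ #(Y.erase y) by rw [card_erase_of_mem hy]; omega)
    (hXY.mono hX' (erase_subset _ _))
    (fun a ha b hb => hG a (hX' ha) b (mem_of_mem_erase hb)) hx
  have h : IsPathList G [x, y] := ⟨by simpa using hxy, by simpa using hxy.ne⟩
  have hd : List.Disjoint [y] l := by
    rw [List.singleton_disjoint]
    intro h
    rcases hmem y h with h | h
    · exact (hG y (hX' h) y hy).ne rfl
    · simp at h
  have := IsPathList.join h hl hd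
  rwa [show [y].length + l.length + 1 = 2 * s + 3 by simp; omega] at this

theorem IsPathList.length_le_of_cover {C : Finset V} {S : Set V}
    (hS : ∀ a b, a ∈ S → G.Adj a b → b ∈ S) (hC : ∀ a b, a ∈ S → G.Adj a b → a ∈ C ∨ b ∈ C)
    {l : List V} (h : IsPathList G (v :: l)) (hv : v ∈ S) :
    l.length ≤ 2 * #C ∧ (v ∈ C → l.length + 1 ≤ 2 * #C) := by
  have key : ∀ (l : List V) (v : V), (v :: l).IsChain G.Adj → v ∈ S →
      l.length ≤ 2 * ((v :: l).filter (· ∈ C)).length ∧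
        (v ∈ C → l.length + 1 ≤ 2 * ((v :: l).filter (· ∈ C)).length) := by
    intro l
    induction l with
    | nil =>
      intro v _ _
      refine ⟨by simp, fun h => by simp [h]⟩
    | cons w l ih =>
      intro v h hv
      rw [List.isChain_cons_cons] at h
      obtain ⟨h₁, h₂⟩ := ih w h.2 (hS v w hv h.1)
      by_cases hvC : v ∈ C
      · rw [List.filter_cons_of_pos (by simpa using hvC)]
        simp only [List.length_cons]
        omega
      · have := h₂ ((hC v w hv h.1).resolve_left hvC)
        rw [List.filter_cons_of_neg (by simpa using hvC)]
        simp only [List.length_cons]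
        exact ⟨by omega, fun h => absurd h hvC⟩
  have hcard : ((v :: l).filter (· ∈ C)).length ≤ #C := by
    rw [← List.toFinset_card_of_nodup (h.2.filter _)]
    refine card_le_card fun x hx => ?_
    simp only [List.mem_toFinset, List.mem_filter, decide_eq_true_eq] at hx
    exact hx.2
  obtain ⟨h₁, h₂⟩ := key l v h.1 hv
  exact ⟨by omega, fun h => by have := h₂ h; omega⟩

/-- A two-colored complete bipartite graph between a set of `2 * s` vertices and a large set,
without monochromatic paths on `2 * s + 3` vertices: each of the `2 * s` vertices ends a monochromatic
path on `2 * s` vertices. -/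
theorem exists_isPathList_of_bipartite {ι : Type*} [Fintype ι] [DecidableEq ι] {s L : ℕ}
    (hs : 1 ≤ s) (hι : Fintype.card ι = 2 * s) (hL : 2 ^ (2 * s) * (s + 1) < L)
    {f : ι → V} {g : Fin L → V} (hf : f.Injective) (hg : g.Injective) (hfg : ∀ i j, f i ≠ g j)
    (hGH : ∀ i j, G.Adj (f i) (g j) ∨ H.Adj (f i) (g j)) (hG : ¬ HasNPath G (2 * s + 3))
    (hH : ¬ HasNPath H (2 * s + 3)) (i : ι) :
    (∃ l, IsPathList G (f i :: l) ∧ l.length + 1 = 2 * s ∧ ∀ z ∈ l, z ∈ Set.range f ∪ Set.range g) ∨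
    (∃ l, IsPathList H (f i :: l) ∧ l.length + 1 = 2 * s ∧
      ∀ z ∈ l, z ∈ Set.range f ∪ Set.range g) := by
  classical
  obtain ⟨T, hT⟩ := Fintype.exists_lt_card_fiber_of_mul_lt_card (n := s + 1)
    (fun j : Fin L => ({i | G.Adj (f i) (g j)} : Finset ι))
    (by simpa [hι] using hL)
  set Y : Finset V :=
    (univ.filter fun j : Fin L => ({i | G.Adj (f i) (g j)} : Finset ι) = T).image g
  have hY : s + 2 ≤ #Y := by
    rw [card_image_of_injective _ hg]
    exact hT
  have hYg : ∀ y ∈ Y, y ∈ Set.range g := by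
    intro y hy
    obtain ⟨j, -, rfl⟩ := mem_image.1 hy
    exact ⟨j, rfl⟩
  have hd : ∀ U : Finset ι, Disjoint (U.image f) Y := by
    intro U
    rw [Finset.disjoint_left]
    intro x hx hx'
    obtain ⟨i, -, rfl⟩ := mem_image.1 hx
    obtain ⟨j, hj⟩ := hYg _ hx'
    exact hfg i j hj.symm
  have hTG : ∀ x ∈ T.image f, ∀ y ∈ Y, G.Adj x y := by
    intro x hx y hy
    obtain ⟨i, hi, rfl⟩ := mem_image.1 hx
    obtain ⟨j, hj, rfl⟩ := mem_image.1 hy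
    rw [← (mem_filter.1 hj).2] at hi
    simpa using hi
  have hTH : ∀ x ∈ Tᶜ.image f, ∀ y ∈ Y, H.Adj x y := by
    intro x hx y hy
    obtain ⟨i, hi, rfl⟩ := mem_image.1 hx
    obtain ⟨j, hj, rfl⟩ := mem_image.1 hy
    rw [← (mem_filter.1 hj).2] at hi
    exact (hGH i j).resolve_left (by simpa using hi)
  have hc : ∀ U : Finset ι, #(U.image f) = #U := fun U => card_image_of_injective _ hf
  have h₁ : #T ≤ s := by
    by_contra h
    exact hG (hasNPath_of_complete (by rw [hc]; omega) hY (hd _) hTG)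
  have h₂ : #Tᶜ ≤ s := by
    by_contra h
    exact hH (hasNPath_of_complete (by rw [hc]; omega) hY (hd _) hTH)
  have h₃ := card_add_card_compl T
  have hsub : ∀ U : Finset ι, ∀ z, z ∈ U.image f ∨ z ∈ Y → z ∈ Set.range f ∪ Set.range g := by
    rintro U z (hz | hz)
    · obtain ⟨i, -, rfl⟩ := mem_image.1 hz
      exact Or.inl ⟨i, rfl⟩
    · exact Or.inr (hYg z hz)
  by_cases hi : i ∈ T
  · obtain ⟨l, hl, hlen, hmem⟩ := exists_isPathList_of_complete hs (X := T.image f) (Y := Y)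
      (by rw [hc]; omega) (by omega) (hd _) hTG (mem_image_of_mem f hi)
    exact Or.inl ⟨l, hl, hlen, fun z hz => hsub _ z (hmem z hz)⟩
  · obtain ⟨l, hl, hlen, hmem⟩ := exists_isPathList_of_complete hs (X := Tᶜ.image f) (Y := Y)
      (by rw [hc]; omega) (by omega) (hd _) hTH (mem_image_of_mem f (by simpa using hi))
    exact Or.inr ⟨l, hl, hlen, fun z hz => hsub _ z (hmem z hz)⟩

end Bipartite

/-! ### The bipartite gadget -/

/-- The bipartite graph given by a relation between the two sides. -/
def bip (r : V → W → Prop) : SimpleGraph (V ⊕ W) where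
  Adj
    | .inl a, .inr b => r a b
    | .inr b, .inl a => r a b
    | _, _ => False
  symm := ⟨by rintro (a | a) (b | b) h <;> exact h⟩
  loopless := ⟨by rintro (a | a) h <;> exact h⟩

variable {q L : ℕ}

variable (q L) in
/-- The vertices of the gadget. -/
abbrev GadgetVertex : Type := Option (Bool × (Fin q ⊕ Fin (q + 1))) ⊕ (Bool × Fin L)

/-- Two complete bipartite graphs, indexed by `Bool`, glued at the vertex `none`. -/
def gadgetRel : Option (Bool × (Fin q ⊕ Fin (q + 1))) → Bool × Fin L → Prop
  | none, _ => True
  | some (i, _), (j, _) => i = j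

/-- A coloring of the edges of the gadget. -/
def gadgetColor : Option (Bool × (Fin q ⊕ Fin (q + 1))) → Bool × Fin L → Bool
  | none, (j, _) => j
  | some (_, .inl _), (j, _) => j
  | some (_, .inr _), (j, _) => !j

variable (q L) in
/-- The edges of color `c` in the gadget. -/
def gadgetClass (c : Bool) : SimpleGraph (GadgetVertex q L) :=
  bip fun a b => gadgetRel a b ∧ gadgetColor a b = c

/-- A set of vertices closed under adjacency in `gadgetClass q L c`. -/
def gadgetPart (c i : Bool) : GadgetVertex q L → Prop
  | .inl none => i = c
  | .inl (some (j, _)) => j = i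
  | .inr (j, _) => j = i

theorem gadgetPart_of_adj {c i : Bool} {a b : GadgetVertex q L} (ha : gadgetPart c i a)
    (hab : (gadgetClass q L c).Adj a b) : gadgetPart c i b := by
  rcases a with (_ | ⟨j, a | a⟩) | ⟨j, a⟩ <;> rcases b with (_ | ⟨j', b | b⟩) | ⟨j', b⟩ <;>
    simp_all [gadgetPart, gadgetClass, bip, gadgetRel, gadgetColor]

theorem exists_gadgetPart (c : Bool) (v : GadgetVertex q L) : ∃ i, gadgetPart c i v := by
  rcases v with (_ | ⟨j, a⟩) | ⟨j, a⟩
  exacts [⟨c, rfl⟩, ⟨j, rfl⟩, ⟨j, rfl⟩]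

/-- A vertex cover of the edges of color `c` in `gadgetPart c i`. -/
def gadgetCover (c i : Bool) : Finset (GadgetVertex q L) :=
  if i = c then Finset.univ.image fun o : Option (Fin q) => .inl (o.map fun t => (i, .inl t))
  else Finset.univ.image fun t : Fin (q + 1) => .inl (some (i, .inr t))

theorem card_gadgetCover_le {c i : Bool} :
    (gadgetCover c i : Finset (GadgetVertex q L)).card ≤ q + 1 := by
  unfold gadgetCover
  split_ifs <;> exact Finset.card_image_le.trans (by simp)

theorem mem_gadgetCover_of_adj {c i : Bool} {a b : GadgetVertex q L} (ha : gadgetPart c i a)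
    (hab : (gadgetClass q L c).Adj a b) : a ∈ gadgetCover c i ∨ b ∈ gadgetCover c i := by
  rcases a with (_ | ⟨j, a | a⟩) | ⟨j, a⟩ <;> rcases b with (_ | ⟨j', b | b⟩) | ⟨j', b⟩ <;>
    simp_all [gadgetPart, gadgetClass, bip, gadgetRel, gadgetColor, gadgetCover]

theorem IsPathList.length_le_of_gadgetClass {c : Bool} {v : GadgetVertex q L}
    {l : List (GadgetVertex q L)} (h : IsPathList (gadgetClass q L c) (v :: l)) :
    l.length ≤ 2 * q + 2 ∧ (v = .inl none → l.length + 1 ≤ 2 * q + 2) := by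
  obtain ⟨i, hv⟩ := exists_gadgetPart c v
  have hC : (gadgetCover c i : Finset (GadgetVertex q L)).card ≤ q + 1 := card_gadgetCover_le
  obtain ⟨h₁, h₂⟩ := h.length_le_of_cover (C := gadgetCover c i) (S := {v | gadgetPart c i v})
    (fun _ _ => gadgetPart_of_adj) (fun _ _ => mem_gadgetCover_of_adj) hv
  refine ⟨by omega, ?_⟩
  rintro rfl
  obtain rfl : i = c := hv
  have := h₂ (by simp [gadgetCover])
  omega

theorem gadgetClass_sdiff : bip gadgetRel \ gadgetClass q L false = gadgetClass q L true := by
  ext (a | a) (b | b) <;> simp +contextual [gadgetClass, bip]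

theorem existsBothForced_even {s : ℕ} (hs : 2 ≤ s) (hk : 2 * s + 2 ≤ k) (hk' : k ≤ 2 * s + 3) :
    ExistsBothForced k (2 * s) := by
  classical
  obtain ⟨q, rfl⟩ : ∃ q, s = q + 1 := ⟨s - 1, by omega⟩
  obtain ⟨L, hL⟩ : ∃ L, L = 2 ^ (2 * (q + 1)) * (q + 1 + 1) + 1 := ⟨_, rfl⟩
  refine ⟨GadgetVertex q L, inferInstance, bip gadgetRel,
    .inl none, fun R hR => ?_, gadgetClass q L false,
    ⟨?_, ?_, ?_⟩, ?_⟩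
  · have hR₁ : ¬ HasNPath R (2 * (q + 1) + 3) := fun h => hR.2.1 (h.mono (by omega) hk')
    have hR₂ : ¬ HasNPath (bip gadgetRel \ R) (2 * (q + 1) + 3) :=
      fun h => hR.2.2 (h.mono (by omega) hk')
    let f (i : Bool) (o : Option (Fin q ⊕ Fin (q + 1))) : GadgetVertex q L :=
      .inl (o.map (Prod.mk i))
    let g (i : Bool) (j : Fin L)  : GadgetVertex q L := .inr (i, j)
    have key (i : Bool) := exists_isPathList_of_bipartite (s := q + 1) (by omega)
      (by simp; omega) (by omega) (f := f i) (g := g i)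
      (fun a b h => Option.map_injective (Prod.mk_right_injective i) (Sum.inl_injective h))
      (fun a b h => by simpa [g] using h) (by simp [f, g])
      (fun o j => adj_or_sdiff_adj (R := R) (G := bip gadgetRel)
        (by cases o <;> simp [f, g, bip, gadgetRel])) hR₁ hR₂ none
    rcases key false with ⟨l, hl, hlen, -⟩ | ⟨l, hl, hlen, hmem⟩
    · exact isPathEndpoint_iff_list.2 ⟨l, hl, hlen⟩
    rcases key true with ⟨l', hl', hlen', -⟩ | ⟨l', hl', hlen', hmem'⟩
    · exact isPathEndpoint_iff_list.2 ⟨l', hl', hlen'⟩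
    refine absurd ((IsPathList.join hl hl' fun z hz hz' => ?_).mono (by omega) (by omega)) hR.2.2
    have hn := (List.nodup_cons.1 hl.2).1
    have h₁ := hmem z hz
    have h₂ := hmem' z hz'
    rcases h₁ with ⟨_ | a, rfl⟩ | ⟨a, rfl⟩
    · exact hn hz
    · rcases h₂ with ⟨_ | b, h⟩ | ⟨b, h⟩ <;> simp [f, g] at h
    · rcases h₂ with ⟨_ | b, h⟩ | ⟨b, h⟩ <;> simp [f, g] at h
  · rintro (a | a) (b | b) h
    exacts [h, h.1, h.1, h]
  · rintro h
    obtain ⟨v, hv⟩ := h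
    obtain ⟨l, hl, hlen⟩ := isPathEndpoint_iff_list.1 hv
    have := hl.length_le_of_gadgetClass.1
    omega
  · rintro h
    rw [gadgetClass_sdiff] at h
    obtain ⟨v, hv⟩ := h
    obtain ⟨l, hl, hlen⟩ := isPathEndpoint_iff_list.1 hv
    have := hl.length_le_of_gadgetClass.1
    omega
  · intro h
    obtain ⟨l, hl, hlen⟩ := isPathEndpoint_iff_list.1 h
    have := hl.length_le_of_gadgetClass.2 rfl
    omega

theorem existsBothForced_sub_two (hk : 3 ≤ k) : ExistsBothForced k (k - 2) := by
  rcases (show k = 3 ∨ k = 4 ∨ k = 5 ∨ 6 ≤ k by omega) with rfl | rfl | rfl | hk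
  · exact existsBothForced_three
  · exact existsBothForced_four
  · exact existsBothForced_five.extend (by omega) (by omega) (by omega)
  · exact (existsBothForced_even (s := (k - 2) / 2) (by omega) (by omega) (by omega)).extend
      (by omega) (by omega) (by omega)

/-- for k ≥ 3 and 2 ≤ x ≤ k−1 there exists a (k, x)-transmitter. -/
theorem stmt7 (k x : ℕ) (hk : 3 ≤ k) (hx2 : 2 ≤ x) (hxk : x ≤ k - 1) :
    ∃ (n : ℕ) (G : SimpleGraph (Fin n)) (v : Fin n),
      IsGood G k k ∧
      ∀ R : SimpleGraph (Fin n), GoodColoring G R k k →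
        (StrictEndpoint R v x ∧ ∀ u, ¬ (G \ R).Adj v u) ∨
        (StrictEndpoint (G \ R) v x ∧ ∀ u, ¬ R.Adj v u) := by
  obtain ⟨y, rfl⟩ : ∃ y, x = y + 1 := ⟨x - 1, by omega⟩
  obtain ⟨V, _, G, u, h⟩ := (existsBothForced_sub_two hk).exists_saturated (y := y)
    (by omega) (by omega)
  obtain ⟨n, ⟨e⟩⟩ := Finite.exists_equiv_fin (Option V)
  have := (h.transmitter (by omega)).comap_equiv e.symm
  exact ⟨n, _, _, this.isGood, this.endpoint⟩
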